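/- (Correctness of the DeePC constraint.) Let A ∈ ℝ^{n×n}, B ∈ ℝ^{n×m}, C ∈ ℝ^{p×n}, D ∈ ℝ^{p×m} with (A,B) controllable, i.e., the controllability matrix [B, AB, …, A^{n−1}B] has rank n. Let T_ini, N be positive integers and T a positive integer with T_ini + N + n ≤ T, and let (u^d, x^d, y^d) be system data of length T: x^d(t+1) = A x^d(t) + B u^d(t), y^d(t) = C x^d(t) + D u^d(t) for 0 ≤ t ≤ T−1, with u^d persistently exciting of order T_ini + N + n. Partition the Hankel matrices as (U_p; U_f) = H_{T_ini+N}(u^d) and (Y_p; Y_f) = H_{T_ini+N}(y^d), where U_p consists of the first m·T_ini rows and U_f the last m·N rows (and analogously Y_p, Y_f with p in place of m). Then for all u_ini ∈ ℝ^{m·T_ini}, y_ini ∈ ℝ^{p·T_ini}, u ∈ ℝ^{m·N}, y ∈ ℝ^{p·N}, there exists g ∈ ℝ^{T−T_ini−N+1} with U_p g = u_ini, Y_p g = y_ini, U_f g = u, Y_f g = y if and only if the concatenated pair (u_ini followed by u, y_ini followed by y) is a length-(T_ini+N) input–output trajectory of (A,B,C,D), i.e., there exists a state sequence x : Fin (T_ini+N+1)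 → ℝ^n satisfying the system recursion with this concatenated input and output. -/

import Mathlib

/-- The block Hankel matrix of depth `L` of a signal `w : Fin T → Fin q → ℝ`.
Its rows are indexed by block pairs `(i, k) : Fin L × Fin q` and its `j`-th column
is the stacked vector `(w j, w (j+1), …, w (j+L-1))`. -/
def blockHankel (T L q : ℕ) (hL : L ≤ T) (w : Fin T → Fin q → ℝ) :
    Matrix (Fin L × Fin q) (Fin (T - L + 1)) ℝ :=
  Matrix.of fun ik j =>
    w ⟨ik.1.1 + j.1, by have h1 := ik.1.isLt; have h2 := j.isLt; omega⟩ ik.2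

/-- The controllability matrix `[B, AB, …, A^{n−1}B]` of a pair `(A, B)`,
with columns indexed by `Fin n × Fin m`. -/
def ctrbMatrix (n m : ℕ) (A : Matrix (Fin n) (Fin n) ℝ) (B : Matrix (Fin n) (Fin m) ℝ) :
    Matrix (Fin n) (Fin n × Fin m) ℝ :=
  Matrix.of fun i kj => (A ^ (kj.1 : ℕ) * B) i kj.2

/-- Concatenation of a length-`Tini` stacked signal with a length-`N` stacked signal
into a length-`(Tini + N)` signal. -/
def concatSig (Tini N q : ℕ) (w₁ : Fin Tini × Fin q → ℝ) (w₂ : Fin N × Fin q → ℝ) :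
    Fin (Tini + N) → Fin q → ℝ :=
  fun t k =>
    if h : t.1 < Tini then w₁ (⟨t.1, h⟩, k)
    else w₂ (⟨t.1 - Tini, by have := t.isLt; omega⟩, k)

open Finset Matrix in
/-- A matrix whose rank is its number of rows has trivial left kernel. -/
theorem eq_zero_of_vecMul_eq_zero_of_rank_eq_card {ι κ : Type*} [Fintype ι] [Fintype κ]
    (M : Matrix ι κ ℝ) (hM : M.rank = Fintype.card ι) {v : ι → ℝ} (hv : v ᵥ* M = 0) : v = 0 := by
  have hli : LinearIndependent ℝ M.row :=
    linearIndependent_iff_card_eq_finrank_span.2 (by rw [← hM, M.rank_eq_finrank_span_row]; rfl)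
  exact vecMul_injective_iff.2 hli (by simpa using hv)

open Finset Matrix in
/-- A matrix with trivial left kernel is surjective. -/
theorem mulVec_surjective_of_vecMul_eq_zero {ι κ : Type*} [Fintype ι] [Fintype κ]
    (M : Matrix ι κ ℝ) (hM : ∀ v : ι → ℝ, v ᵥ* M = 0 → v = 0) :
    Function.Surjective M.mulVec := by
  have hinj : Function.Injective M.vecMul :=
    (injective_iff_map_eq_zero M.vecMulLinear).2 hM
  have hrank := (vecMul_injective_iff.1 hinj).rank_matrix
  have htop : LinearMap.range M.mulVecLin = ⊤ :=
    Submodule.eq_top_of_finrank_eq (by rw [Module.finrank_fintype_fun_eq_card, ← hrank]; rfl)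
  exact LinearMap.range_eq_top.1 htop

/-- Extension of a finite signal by zero. -/
def extendSig {T q : ℕ} (w : Fin T → Fin q → ℝ) (t : ℕ) : Fin q → ℝ :=
  if h : t < T then w ⟨t, h⟩ else 0

theorem extendSig_of_lt {T q : ℕ} (w : Fin T → Fin q → ℝ) {t : ℕ} (h : t < T) :
    extendSig w t = w ⟨t, h⟩ := dif_pos h

open Finset Matrix in
theorem vecMul_blockHankel {T L q : ℕ} (hL : L ≤ T) (w : Fin T → Fin q → ℝ)
    (v : Fin L × Fin q → ℝ) (c : ℕ → Fin q → ℝ) (hc : ∀ s : Fin L, ∀ k, v (s, k) = c s k)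
    (j : Fin (T - L + 1)) :
    (v ᵥ* blockHankel T L q hL w) j = ∑ s ∈ range L, c s ⬝ᵥ extendSig w (j + s) := by
  rw [← Fin.sum_univ_eq_sum_range (fun s => c s ⬝ᵥ extendSig w (j + s))]
  simp only [vecMul, dotProduct, Fintype.sum_prod_type]
  refine sum_congr rfl fun s _ => sum_congr rfl fun k _ => ?_
  rw [hc, extendSig_of_lt w (show (j : ℕ) + s < T by omega)]
  simp [blockHankel, add_comm]

open Finset Matrix in
theorem blockHankel_mulVec {T L q : ℕ} (hL : L ≤ T) (w : Fin T → Fin q → ℝ)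
    (g : Fin (T - L + 1) → ℝ) (t : Fin L) (k : Fin q) :
    (blockHankel T L q hL w *ᵥ g) (t, k) = (∑ j, g j • extendSig w (j + t)) k := by
  simp only [mulVec, dotProduct, Finset.sum_apply, Pi.smul_apply, smul_eq_mul]
  refine sum_congr rfl fun j _ => ?_
  rw [extendSig_of_lt w (show (j : ℕ) + t < T by omega), mul_comm]
  simp [blockHankel, add_comm]

open Finset Matrix in
/-- The shifted annihilation relations along a trajectory: the coefficient sequence `z`
extends `η` (reversed) by the Markov-like parameters `ξᵀ A ^ r B`. -/
theorem shifted_annihilator {n m T L : ℕ} (A : Matrix (Fin n) (Fin n) ℝ)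
    (B : Matrix (Fin n) (Fin m) ℝ) (u : ℕ → Fin m → ℝ) (x : ℕ → Fin n → ℝ)
    (hdyn : ∀ t < T, x (t + 1) = A *ᵥ x t + B *ᵥ u t) (ξ : Fin n → ℝ) (z : ℕ → Fin m → ℝ)
    (hz : ∀ r, z (L + r) = (ξ ᵥ* A ^ r) ᵥ* B)
    (h : ∀ j, j + L ≤ T → ξ ⬝ᵥ x j + ∑ s ∈ range L, z (L - 1 - s) ⬝ᵥ u (j + s) = 0) (k : ℕ) :
    ∀ j, j + L + k ≤ T →
      (ξ ᵥ* A ^ k) ⬝ᵥ x j + ∑ s ∈ range (L + k), z (L + k - 1 - s) ⬝ᵥ u (j + s) = 0 := by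
  induction k with
  | zero => simpa using h
  | succ k ih =>
    intro j hj
    have := ih (j + 1) (by omega)
    rw [hdyn j (by omega), dotProduct_add, dotProduct_mulVec, dotProduct_mulVec, vecMul_vecMul,
      ← pow_succ, ← hz] at this
    have hshift : ∑ s ∈ range (L + k), z (L + k - (s + 1)) ⬝ᵥ u (j + (s + 1))
        = ∑ s ∈ range (L + k), z (L + k - 1 - s) ⬝ᵥ u (j + 1 + s) :=
      sum_congr rfl fun s _ => by
        rw [show L + k - (s + 1) = L + k - 1 - s by omega,
          show j + (s + 1) = j + 1 + s by omega]
    rw [← add_assoc L k 1, sum_range_succ', Nat.add_sub_cancel, hshift, Nat.sub_zero, add_zero,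
      add_comm (∑ s ∈ range (L + k), _), ← add_assoc]
    exact this

open Finset in
/-- A sequence annihilated by a monic recursion with zero initial data vanishes. -/
theorem eq_zero_of_monic_recursion {E : Type*} [AddCommGroup E] [Module ℝ E] {n R : ℕ}
    (c : ℕ → ℝ) (hc : c n = 1) (z : ℕ → E)
    (h : ∀ r < R, ∑ k ∈ range (n + 1), c k • (if n ≤ r + k then z (r + k - n) else 0) = 0) :
    ∀ r < R, z r = 0 := by
  intro r
  induction r using Nat.strong_induction_on with
  | _ r ih =>
    intro hr
    have := h r hr
    rw [sum_range_succ, sum_eq_zero] at this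
    · simpa [hc] using this
    · intro k hk
      rw [mem_range] at hk
      split_ifs with hrk
      · rw [ih _ (by omega) (by omega), smul_zero]
      · rw [smul_zero]

open Finset Matrix in
/-- Persistency of excitation of order `L + n` and controllability imply that no nontrivial
combination of the state and `L` consecutive inputs vanishes along the data. -/
theorem annihilator_eq_zero {n m T L : ℕ} (A : Matrix (Fin n) (Fin n) ℝ)
    (B : Matrix (Fin n) (Fin m) ℝ) (hctrb : (ctrbMatrix n m A B).rank = n)
    (u : ℕ → Fin m → ℝ) (x : ℕ → Fin n → ℝ)
    (hdyn : ∀ t < T, x (t + 1) = A *ᵥ x t + B *ᵥ u t)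
    (hPE : ∀ c : ℕ → Fin m → ℝ,
      (∀ j, j + (L + n) ≤ T → ∑ s ∈ range (L + n), c s ⬝ᵥ u (j + s) = 0) →
        ∀ s < L + n, c s = 0)
    (ξ : Fin n → ℝ) (η : ℕ → Fin m → ℝ)
    (h : ∀ j, j + L ≤ T → ξ ⬝ᵥ x j + ∑ s ∈ range L, η s ⬝ᵥ u (j + s) = 0) :
    ξ = 0 ∧ ∀ s < L, η s = 0 := by
  let z : ℕ → Fin m → ℝ := fun r =>
    if r < L then η (L - 1 - r) else (ξ ᵥ* A ^ (r - L)) ᵥ* B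
  have hzη : ∀ s < L, z (L - 1 - s) = η s := fun s hs => by
    simp only [z]
    rw [if_pos (by omega), show L - 1 - (L - 1 - s) = s by omega]
  have hzξ : ∀ r, z (L + r) = (ξ ᵥ* A ^ r) ᵥ* B := fun r => by simp [z]
  have hann := shifted_annihilator (T := T) A B u x hdyn ξ z hzξ fun j hj => by
    rw [← h j hj]
    congr 1
    exact sum_congr rfl fun s hs => by rw [hzη s (mem_range.1 hs)]
  have hCH : ∑ k ∈ range (n + 1), A.charpoly.coeff k • A ^ k = 0 := by
    have := A.aeval_self_charpoly
    rwa [Polynomial.aeval_eq_sum_range, A.charpoly_natDegree_eq_dim, Fintype.card_fin] at this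
  have hcn : A.charpoly.coeff n = 1 := by
    simpa [Polynomial.Monic, Polynomial.leadingCoeff] using A.charpoly_monic
  have hrec := hPE
    (fun s => ∑ k ∈ range (n + 1), A.charpoly.coeff k •
      (if s < L + k then z (L + k - 1 - s) else 0)) (by
    intro j hj
    have hstate : ∑ k ∈ range (n + 1), A.charpoly.coeff k • ((ξ ᵥ* A ^ k) ⬝ᵥ x j) = 0 := by
      have := congrArg (fun M => (ξ ᵥ* M) ⬝ᵥ x j) hCH
      simpa [vecMul_sum, sum_dotProduct, vecMul_smul] using this
    calc _ = ∑ k ∈ range (n + 1), A.charpoly.coeff k •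
          ∑ s ∈ range (L + k), z (L + k - 1 - s) ⬝ᵥ u (j + s) := by
          simp only [sum_dotProduct, smul_dotProduct]
          rw [sum_comm]
          refine sum_congr rfl fun k hk => ?_
          rw [mem_range] at hk
          rw [← smul_sum]
          congr 1
          symm
          apply sum_subset_zero_on_sdiff (range_subset_range.2 (by omega))
          · intro s hs
            simp only [mem_sdiff, mem_range] at hs
            rw [if_neg hs.2, zero_dotProduct]
          · intro s hs
            rw [if_pos (mem_range.1 hs)]
      _ = 0 := by
          refine (add_eq_right.2 hstate).symm.trans ?_
          rw [← sum_add_distrib]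
          refine sum_eq_zero fun k hk => ?_
          rw [mem_range] at hk
          rw [← smul_add, hann k j (by omega), smul_zero])
  have hz0 : ∀ r < L + n, z r = 0 := by
    refine eq_zero_of_monic_recursion A.charpoly.coeff hcn z fun r hr => ?_
    refine Eq.trans ?_ (hrec (L + n - 1 - r) (by omega))
    refine sum_congr rfl fun k hk => ?_
    rw [mem_range] at hk
    congr 1
    by_cases hrk : n ≤ r + k
    · rw [if_pos hrk, if_pos (by omega)]
      congr 1
      omega
    · rw [if_neg hrk, if_neg (by omega)]
  refine ⟨?_, fun s hs => by rw [← hzη s hs, hz0 _ (by omega)]⟩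
  refine eq_zero_of_vecMul_eq_zero_of_rank_eq_card (ctrbMatrix n m A B) (by simpa using hctrb) ?_
  ext ⟨k, i⟩
  have := congrFun (hz0 (L + k) (by omega)) i
  rw [hzξ, vecMul_vecMul] at this
  exact this

open Finset Matrix in
/-- The fundamental lemma: the data generate every initial state and input sequence. -/
theorem exists_state_input_combination {n m T L : ℕ} (hL : L + n ≤ T)
    (A : Matrix (Fin n) (Fin n) ℝ)
    (B : Matrix (Fin n) (Fin m) ℝ) (hctrb : (ctrbMatrix n m A B).rank = n)
    (ud : Fin T → Fin m → ℝ) (x : ℕ → Fin n → ℝ)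
    (hdyn : ∀ t < T, x (t + 1) = A *ᵥ x t + B *ᵥ extendSig ud t)
    (hPE : (blockHankel T (L + n) m hL ud).rank = m * (L + n))
    (x₀ : Fin n → ℝ) (v : Fin L → Fin m → ℝ) :
    ∃ g : Fin (T - L + 1) → ℝ, ∑ j, g j • x j = x₀ ∧
      ∀ t : Fin L, ∑ j, g j • extendSig ud (j + t) = v t := by
  let M : Matrix (Fin n ⊕ Fin L × Fin m) (Fin (T - L + 1)) ℝ :=
    fromRows (of fun i j => x j i) (blockHankel T L m (by omega) ud)
  have hM : Function.Surjective M.mulVec := by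
    refine mulVec_surjective_of_vecMul_eq_zero M fun w hw => ?_
    let η : ℕ → Fin m → ℝ := fun s k => if h : s < L then w (Sum.inr (⟨s, h⟩, k)) else 0
    have hη : ∀ s : Fin L, ∀ k, w (Sum.inr (s, k)) = η s k := fun s k => by simp [η]
    obtain ⟨h1, h2⟩ := annihilator_eq_zero (T := T) (L := L) A B hctrb (extendSig ud) x hdyn
      (fun c hc s hs => by
        have := eq_zero_of_vecMul_eq_zero_of_rank_eq_card (blockHankel T (L + n) m hL ud)
          (by simpa [mul_comm] using hPE) (v := fun sk => c sk.1 sk.2) (by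
            ext j
            rw [vecMul_blockHankel hL ud _ c fun _ _ => rfl]
            exact hc j (by omega))
        ext k
        exact congrFun this (⟨s, hs⟩, k))
      (fun i => w (Sum.inl i)) η (fun j hj => by
        rw [← vecMul_blockHankel (by omega) ud (fun sk => w (Sum.inr sk)) η hη
          ⟨j, by omega⟩]
        have := congrFun hw ⟨j, by omega⟩
        rwa [vecMul_fromRows] at this)
    ext (i | ⟨s, k⟩)
    · exact congrFun h1 i
    · rw [hη, h2 s s.2]
      rfl
  obtain ⟨g, hg⟩ := hM (Sum.elim x₀ fun tk => v tk.1 tk.2)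
  rw [fromRows_mulVec, Sum.elim_eq_iff] at hg
  refine ⟨g, ?_, fun t => ?_⟩
  · rw [← hg.1]
    ext i
    simp [mulVec, dotProduct, mul_comm]
  · ext k
    rw [← blockHankel_mulVec (by omega), hg.2]

open Finset Matrix in
/-- Linear combinations of data windows obey the linear relation of the system. -/
theorem sum_smul_linear {ι : Type*} [Fintype ι] {a b c : ℕ} (A : Matrix (Fin c) (Fin a) ℝ)
    (B : Matrix (Fin c) (Fin b) ℝ) (g : ι → ℝ) (x : ι → Fin a → ℝ) (u : ι → Fin b → ℝ)
    (w : ι → Fin c → ℝ) (h : ∀ j, w j = A *ᵥ x j + B *ᵥ u j) :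
    ∑ j, g j • w j = A *ᵥ (∑ j, g j • x j) + B *ᵥ (∑ j, g j • u j) := by
  simp only [h, mulVec_sum, mulVec_smul, smul_add, sum_add_distrib]

theorem concatSig_castAdd {Tini N q : ℕ} (w₁ : Fin Tini × Fin q → ℝ) (w₂ : Fin N × Fin q → ℝ)
    (t : Fin Tini) (k : Fin q) : concatSig Tini N q w₁ w₂ (Fin.castAdd N t) k = w₁ (t, k) := by
  simp [concatSig]

theorem concatSig_natAdd {Tini N q : ℕ} (w₁ : Fin Tini × Fin q → ℝ) (w₂ : Fin N × Fin q → ℝ)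
    (t : Fin N) (k : Fin q) : concatSig Tini N q w₁ w₂ (Fin.natAdd Tini t) k = w₂ (t, k) := by
  simp [concatSig]

/-- The past and future Hankel constraints together prescribe the concatenated window. -/
theorem blockHankel_mulVec_eq_concatSig_iff {T Tini N q : ℕ} (hL : Tini + N ≤ T)
    (w : Fin T → Fin q → ℝ) (g : Fin (T - (Tini + N) + 1) → ℝ)
    (w₁ : Fin Tini × Fin q → ℝ) (w₂ : Fin N × Fin q → ℝ) :
    ((∀ (t : Fin Tini) (k : Fin q),
        (blockHankel T (Tini + N) q hL w).mulVec g (Fin.castAdd N t, k) = w₁ (t, k)) ∧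
      ∀ (t : Fin N) (k : Fin q),
        (blockHankel T (Tini + N) q hL w).mulVec g (Fin.natAdd Tini t, k) = w₂ (t, k)) ↔
    ∀ t : Fin (Tini + N),
      ∑ j, g j • extendSig w (j + t) = concatSig Tini N q w₁ w₂ t := by
  rw [Fin.forall_fin_add]
  simp only [blockHankel_mulVec, funext_iff, concatSig_castAdd, concatSig_natAdd]

/-- **Correctness of the DeePC constraint.** Under controllability of `(A, B)` and
persistency of excitation of `uᵈ` of order `T_ini + N + n`, a quadruple
`(u_ini, y_ini, u, y)` satisfies the DeePC linear constraint
`U_p g = u_ini, Y_p g = y_ini, U_f g = u, Y_f g = y` for some `g` if and only if the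
concatenated pair `(u_ini ⧺ u, y_ini ⧺ y)` is a length-`(T_ini + N)` input–output
trajectory of the system. Here `U_p`/`Y_p` (resp. `U_f`/`Y_f`) are the first `T_ini`
(resp. last `N`) block rows of the depth-`(T_ini + N)` Hankel matrices of `uᵈ`/`yᵈ`. -/
theorem deepc_constraint_correct (n m p T Tini N : ℕ)
    (hTini : 0 < Tini) (hN : 0 < N) (hT : 0 < T)
    (A : Matrix (Fin n) (Fin n) ℝ) (B : Matrix (Fin n) (Fin m) ℝ)
    (C : Matrix (Fin p) (Fin n) ℝ) (D : Matrix (Fin p) (Fin m) ℝ)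
    (hctrb : (ctrbMatrix n m A B).rank = n)
    (hTlen : Tini + N + n ≤ T)
    (ud : Fin T → Fin m → ℝ) (xd : Fin (T + 1) → Fin n → ℝ) (yd : Fin T → Fin p → ℝ)
    (hdyn : ∀ t : Fin T,
      xd t.succ = A.mulVec (xd t.castSucc) + B.mulVec (ud t) ∧
      yd t = C.mulVec (xd t.castSucc) + D.mulVec (ud t))
    (hPE : (blockHankel T (Tini + N + n) m hTlen ud).rank = m * (Tini + N + n))
    (u_ini : Fin Tini × Fin m → ℝ) (y_ini : Fin Tini × Fin p → ℝ)
    (u : Fin N × Fin m → ℝ) (y : Fin N × Fin p → ℝ) :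
    (∃ g : Fin (T - (Tini + N) + 1) → ℝ,
        (∀ (t : Fin Tini) (k : Fin m),
          (blockHankel T (Tini + N) m (by omega) ud).mulVec g (Fin.castAdd N t, k)
            = u_ini (t, k)) ∧
        (∀ (t : Fin Tini) (i : Fin p),
          (blockHankel T (Tini + N) p (by omega) yd).mulVec g (Fin.castAdd N t, i)
            = y_ini (t, i)) ∧
        (∀ (t : Fin N) (k : Fin m),
          (blockHankel T (Tini + N) m (by omega) ud).mulVec g (Fin.natAdd Tini t, k)
            = u (t, k)) ∧
        (∀ (t : Fin N) (i : Fin p),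
          (blockHankel T (Tini + N) p (by omega) yd).mulVec g (Fin.natAdd Tini t, i)
            = y (t, i)))
      ↔
    (∃ x : Fin (Tini + N + 1) → Fin n → ℝ, ∀ t : Fin (Tini + N),
        x t.succ = A.mulVec (x t.castSucc)
            + B.mulVec (concatSig Tini N m u_ini u t) ∧
        concatSig Tini N p y_ini y t
          = C.mulVec (x t.castSucc) + D.mulVec (concatSig Tini N m u_ini u t)) := by
  have hx : ∀ t < T, extendSig xd (t + 1) = A.mulVec (extendSig xd t)
      + B.mulVec (extendSig ud t) := fun t ht => by
    rw [extendSig_of_lt xd (show t + 1 < T + 1 by omega),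
      extendSig_of_lt xd (show t < T + 1 by omega), extendSig_of_lt ud ht]
    exact (hdyn ⟨t, ht⟩).1
  have hy : ∀ t < T, extendSig yd t = C.mulVec (extendSig xd t)
      + D.mulVec (extendSig ud t) := fun t ht => by
    rw [extendSig_of_lt yd ht, extendSig_of_lt xd (show t < T + 1 by omega),
      extendSig_of_lt ud ht]
    exact (hdyn ⟨t, ht⟩).2
  have hstate : ∀ (g : Fin (T - (Tini + N) + 1) → ℝ) (t : Fin (Tini + N)),
      ∑ j, g j • extendSig xd (j + (t + 1)) = A.mulVec (∑ j, g j • extendSig xd (j + t))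
        + B.mulVec (∑ j, g j • extendSig ud (j + t)) := fun g t =>
    sum_smul_linear A B g _ _ _ fun j => hx (j + t) (by omega)
  have houtput : ∀ (g : Fin (T - (Tini + N) + 1) → ℝ) (t : Fin (Tini + N)),
      ∑ j, g j • extendSig yd (j + t) = C.mulVec (∑ j, g j • extendSig xd (j + t))
        + D.mulVec (∑ j, g j • extendSig ud (j + t)) := fun g t =>
    sum_smul_linear C D g _ _ _ fun j => hy (j + t) (by omega)
  have hLT : Tini + N ≤ T := by omega
  constructor
  · rintro ⟨g, hup, hyp, huf, hyf⟩
    have hu := (blockHankel_mulVec_eq_concatSig_iff hLT ud g u_ini u).1 ⟨hup, huf⟩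
    have hyc := (blockHankel_mulVec_eq_concatSig_iff hLT yd g y_ini y).1 ⟨hyp, hyf⟩
    refine ⟨fun t => ∑ j, g j • extendSig xd (j + t), fun t => ⟨?_, ?_⟩⟩
    · rw [← hu]
      exact hstate g t
    · rw [← hu, ← hyc]
      exact houtput g t
  · rintro ⟨x, hxt⟩
    obtain ⟨g, hg0, hgu⟩ := exists_state_input_combination hTlen A B hctrb ud (extendSig xd) hx
      hPE (x 0) (concatSig Tini N m u_ini u)
    have hgx : ∀ t : Fin (Tini + N + 1), ∑ j, g j • extendSig xd (j + t) = x t := by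
      intro t
      induction t using Fin.induction with
      | zero => exact hg0
      | succ t ih =>
        rw [(hxt t).1, ← hgu, ← ih]
        exact hstate g t
    have hgy : ∀ t : Fin (Tini + N),
        ∑ j, g j • extendSig yd (j + t) = concatSig Tini N p y_ini y t := fun t => by
      rw [(hxt t).2, ← hgu, ← hgx]
      exact houtput g t
    obtain ⟨hup, huf⟩ := (blockHankel_mulVec_eq_concatSig_iff hLT ud g u_ini u).2 hgu
    obtain ⟨hyp, hyf⟩ := (blockHankel_mulVec_eq_concatSig_iff hLT yd g y_ini y).2 hgy
    exact ⟨g, hup, hyp, huf, hyf⟩
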